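/- Let ≺ be a strict total order on ℕ. Then every positive root ε_i − ε_j with i ≺ j lies in the additive submonoid of (ℕ →₀ ℤ) generated by the simple roots if and only if the ordered set (ℕ, ≺) is order-isomorphic to one of (ℕ, <), the order dual of (ℕ, <), or (ℤ, <). (In the terminology of the paper: the Dynkin Borel subalgebras are exactly the Borel subalgebras of sl(∞) for which every positive root is a finite sum of simple roots.) -/

import Mathlib

/-- `ε i = Finsupp.single i 1` in `ℕ →₀ ℤ`. -/
noncomputable def eps (i : ℕ) : ℕ →₀ ℤ := Finsupp.single i 1

/-- The simple roots attached to a strict order `r` on `ℕ`: the `ε_a - ε_b` with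
`a ≺ b` and no `c` strictly between `a` and `b`. -/
def simpleRoots (r : ℕ → ℕ → Prop) : Set (ℕ →₀ ℤ) :=
  {x | ∃ a b : ℕ, r a b ∧ (¬ ∃ c : ℕ, r a c ∧ r c b) ∧ x = eps a - eps b}

theorem aux_nat {α : Type} [LinearOrder α] [LocallyFiniteOrder α] [Infinite α]
    (b : α) (hb : ∀ x, b ≤ x) : Nonempty (α ≃o ℕ) := by
  letI : OrderBot α := { bot := b, bot_le := hb }
  letI : SuccOrder α := LinearLocallyFiniteOrder.succOrder α
  letI : PredOrder α := LinearLocallyFiniteOrder.predOrder α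
  haveI : NoMaxOrder α := by
    refine ⟨fun a => ?_⟩
    by_contra! h
    have : (Set.univ : Set α).Finite :=
      (Set.finite_Icc b a).subset (fun x _ => ⟨hb x, h x⟩)
    exact Set.infinite_univ this
  exact ⟨orderIsoNatOfLinearSuccPredArch⟩

theorem aux_iso {α : Type} [LinearOrder α] [LocallyFiniteOrder α] [Infinite α] :
    Nonempty (α ≃o ℕ) ∨ Nonempty (α ≃o ℕᵒᵈ) ∨ Nonempty (α ≃o ℤ) := by
  by_cases h1 : ∃ b : α, ∀ x, b ≤ x
  · obtain ⟨b, hb⟩ := h1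
    exact Or.inl (aux_nat b hb)
  by_cases h2 : ∃ b : α, ∀ x, x ≤ b
  · obtain ⟨b, hb⟩ := h2
    haveI : Infinite αᵒᵈ := inferInstanceAs (Infinite α)
    obtain ⟨e⟩ := aux_nat (α := αᵒᵈ) (OrderDual.toDual b) (fun x => hb (OrderDual.ofDual x))
    exact Or.inr (Or.inl ⟨(OrderIso.dualDual α).trans e.dual⟩)
  push Not at h1 h2
  haveI : NoMaxOrder α := ⟨h2⟩
  haveI : NoMinOrder α := ⟨h1⟩
  letI : SuccOrder α := LinearLocallyFiniteOrder.succOrder α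
  letI : PredOrder α := LinearLocallyFiniteOrder.predOrder α
  exact Or.inr (Or.inr ⟨orderIsoIntOfLinearSuccPredArch⟩)

theorem aux_rel {α : Type} [Infinite α] (r : α → α → Prop) (hr : IsStrictTotalOrder α r)
    (hf : ∀ i j, {c | r i c ∧ r c j}.Finite) :
    (Nonempty (r ≃r ((· < ·) : ℕ → ℕ → Prop)) ∨
     Nonempty (r ≃r ((· < ·) : ℕᵒᵈ → ℕᵒᵈ → Prop)) ∨
     Nonempty (r ≃r ((· < ·) : ℤ → ℤ → Prop))) := by
  classical
  letI : LinearOrder α := linearOrderOfSTO r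
  letI : LocallyFiniteOrder α := LocallyFiniteOrder.ofFiniteIcc (fun a b => by
    refine ((hf a b).union (Set.toFinite {a, b})).subset ?_
    rintro x ⟨hx1, hx2⟩
    rcases eq_or_lt_of_le hx1 with h | h
    · exact Or.inr (Or.inl h.symm)
    rcases eq_or_lt_of_le hx2 with h' | h'
    · exact Or.inr (Or.inr h')
    exact Or.inl ⟨h, h'⟩)
  rcases aux_iso (α := α) with ⟨⟨e⟩⟩ | ⟨⟨e⟩⟩ | ⟨⟨e⟩⟩
  · exact Or.inl ⟨e.toRelIsoLT⟩
  · exact Or.inr (Or.inl ⟨e.toRelIsoLT⟩)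
  · exact Or.inr (Or.inr ⟨e.toRelIsoLT⟩)

theorem aux_finite_of_iso {β : Type} [Preorder β] [LocallyFiniteOrder β]
    (r : ℕ → ℕ → Prop) (e : r ≃r ((· < ·) : β → β → Prop)) (i j : ℕ) :
    {c | r i c ∧ r c j}.Finite := by
  refine ((Set.finite_Ioo (e i) (e j)).preimage e.injective.injOn).subset ?_
  rintro c ⟨h1, h2⟩
  exact ⟨e.map_rel_iff.2 h1, e.map_rel_iff.2 h2⟩

theorem aux_mem (r : ℕ → ℕ → Prop) (hr : IsStrictTotalOrder ℕ r)
    (hf : ∀ i j, {c | r i c ∧ r c j}.Finite) (n : ℕ) : ∀ i j : ℕ, r i j →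
    {c | r i c ∧ r c j}.ncard = n →
    eps i - eps j ∈ AddSubmonoid.closure (simpleRoots r) := by
  induction n using Nat.strong_induction_on with
  | _ n ih =>
    intro i j hij hn
    by_cases h : ∃ c, r i c ∧ r c j
    · obtain ⟨c, h1, h2⟩ := h
      have hs : eps i - eps j = (eps i - eps c) + (eps c - eps j) := by abel
      rw [hs]
      refine add_mem (ih _ ?_ i c h1 rfl) (ih _ ?_ c j h2 rfl)
      · rw [← hn]
        refine Set.ncard_lt_ncard ?_ (hf i j)
        refine ⟨fun x hx => ⟨hx.1, _root_.trans hx.2 h2⟩, fun hsub => ?_⟩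
        exact irrefl_of r c (hsub ⟨h1, h2⟩).2
      · rw [← hn]
        refine Set.ncard_lt_ncard ?_ (hf i j)
        refine ⟨fun x hx => ⟨_root_.trans h1 hx.1, hx.2⟩, fun hsub => ?_⟩
        exact irrefl_of r c (hsub ⟨h1, h2⟩).1
    · exact AddSubmonoid.subset_closure ⟨i, j, hij, h, rfl⟩

open Classical in
/-- Sum of the coordinates at indices not above `d`. -/
noncomputable def cutSum (r : ℕ → ℕ → Prop) (d : ℕ) : (ℕ →₀ ℤ) →ₗ[ℤ] ℤ :=
  Finsupp.linearCombination ℤ (fun c => if r d c then (0 : ℤ) else 1)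

open Classical in
theorem cutSum_eps (r : ℕ → ℕ → Prop) (d a : ℕ) :
    cutSum r d (eps a) = if r d a then (0 : ℤ) else 1 := by
  simp [cutSum, eps]

theorem aux_cut (r : ℕ → ℕ → Prop) (hr : IsStrictTotalOrder ℕ r) (x : ℕ →₀ ℤ)
    (hx : x ∈ AddSubmonoid.closure (simpleRoots r)) : {d | cutSum r d x ≠ 0}.Finite := by
  induction hx using AddSubmonoid.closure_induction with
  | mem x hx =>
    obtain ⟨a, b, hab, hn, rfl⟩ := hx
    refine (Set.finite_singleton a).subset ?_
    intro d hd
    simp only [Set.mem_setOf_eq, map_sub, cutSum_eps] at hd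
    rcases trichotomous_of r d a with h | h | h
    · exact absurd (by simp [h, (_root_.trans h hab : r d b)]) hd
    · exact h
    · have h1 : ¬ r d a := fun h' => asymm_of r h h'
      have h2 : ¬ r d b := fun h' => hn ⟨d, h, h'⟩
      exact absurd (by simp [h1, h2]) hd
  | zero => simp
  | add x y _ _ hx hy =>
    refine (hx.union hy).subset ?_
    intro d hd
    by_contra h
    simp only [Set.mem_union, Set.mem_setOf_eq, not_or, not_not] at h
    exact hd (by rw [map_add, h.1, h.2, add_zero])

theorem stmt2 (r : ℕ → ℕ → Prop) (hr : IsStrictTotalOrder ℕ r) :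
    (∀ i j : ℕ, r i j → eps i - eps j ∈ AddSubmonoid.closure (simpleRoots r)) ↔
    (Nonempty (r ≃r ((· < ·) : ℕ → ℕ → Prop)) ∨
     Nonempty (r ≃r ((· < ·) : ℕᵒᵈ → ℕᵒᵈ → Prop)) ∨
     Nonempty (r ≃r ((· < ·) : ℤ → ℤ → Prop))) := by
  constructor
  · intro H
    refine aux_rel r hr (fun i j => ?_)
    by_cases hij : r i j
    · refine (aux_cut r hr _ (H i j hij)).subset ?_
      rintro c ⟨h1, h2⟩
      have h3 : ¬ r c i := fun h' => asymm_of r h1 h'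
      simp [cutSum_eps, h2, h3]
    · refine Set.finite_empty.subset ?_
      rintro c ⟨h1, h2⟩
      exact hij (_root_.trans h1 h2)
  · intro H i j hij
    refine aux_mem r hr ?_ _ i j hij rfl
    rcases H with ⟨⟨e⟩⟩ | ⟨⟨e⟩⟩ | ⟨⟨e⟩⟩
    · exact aux_finite_of_iso r e
    · exact aux_finite_of_iso r e
    · exact aux_finite_of_iso r e
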